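/- A birth-death process X has asymptotic period d(X) = ∞ if and only if the infinite product ∏_{i=0}^∞ p_i is strictly positive. -/

import Mathlib

open MeasureTheory Filter Set ProbabilityTheory

/-- A discrete-time Markov chain on a state space `S`: a stochastic transition
matrix `P`, an initial distribution `init`, and the induced probability measure
`μ` on the path space `ℕ → S`, determined by its values on cylinder sets. -/
structure MarkovChain (S : Type) [MeasurableSpace S] where
  P : S → S → ℝ
  P_nonneg : ∀ i j, 0 ≤ P i j
  P_stochastic : ∀ i, HasSum (P i) 1
  init : S → ℝ
  init_nonneg : ∀ i, 0 ≤ init i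
  init_hasSum : HasSum init 1
  μ : Measure (ℕ → S)
  μ_prob : IsProbabilityMeasure μ
  μ_cylinder : ∀ (n : ℕ) (s : ℕ → S),
    μ {ω | ∀ k ≤ n, ω k = s k}
      = ENNReal.ofReal (init (s 0) * ∏ k ∈ Finset.range n, P (s k) (s (k + 1)))

namespace MarkovChain

variable {S : Type} [MeasurableSpace S]

open Classical in
/-- The `n`-step transition probabilities `P^n(i,j)`. -/
noncomputable def Pn (X : MarkovChain S) : ℕ → S → S → ℝ
  | 0, i, j => if i = j then 1 else 0
  | n + 1, i, j => ∑' k : S, X.Pn n i k * X.P k j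

/-- Irreducibility: every state can be reached from every state. -/
def Irreducible (X : MarkovChain S) : Prop := ∀ i j : S, ∃ n : ℕ, 0 < X.Pn n i j

/-- Aperiodicity: for each state, the gcd of the set `{n ≥ 1 | P^n(i,i) > 0}`
is `1` (expressed via common divisors). -/
def Aperiodic (X : MarkovChain S) : Prop :=
  ∀ i : S, ∀ d : ℕ, (∀ n : ℕ, 0 < n → 0 < X.Pn n i i → d ∣ n) → d = 1

/-- `U^(m)(C)`: the event that the `m`-step chain visits `C` infinitely often. -/
def U (X : MarkovChain S) (m : ℕ) (C : Set S) : Set (ℕ → S) :=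
  {ω | ∀ n : ℕ, ∃ k : ℕ, n ≤ k ∧ ω (k * m) ∈ C}

/-- `L^(m)(C)`: the event that the `m`-step chain is eventually in `C`. -/
def L (X : MarkovChain S) (m : ℕ) (C : Set S) : Set (ℕ → S) :=
  {ω | ∃ n : ℕ, ∀ k : ℕ, n ≤ k → ω (k * m) ∈ C}

/-- `C` is transient with respect to the `m`-step chain `X^(m)`. -/
def Transient (X : MarkovChain S) (m : ℕ) (C : Set S) : Prop := X.μ (X.U m C) = 0

/-- `C` is regular with respect to `X^(m)`: `U^(m)(C)` and `L^(m)(C)` agree up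
to a null event. -/
def Regular (X : MarkovChain S) (m : ℕ) (C : Set S) : Prop :=
  X.μ (symmDiff (X.U m C) (X.L m C)) = 0

/-- `C` is almost closed with respect to `X^(m)`: regular but not transient. -/
def AlmostClosed (X : MarkovChain S) (m : ℕ) (C : Set S) : Prop :=
  X.Regular m C ∧ ¬ X.Transient m C

/-- An almost closed set is atomic if it does not contain two disjoint almost
closed subsets. -/
def Atomic (X : MarkovChain S) (m : ℕ) (C : Set S) : Prop :=
  X.AlmostClosed m C ∧
    ¬ ∃ A B : Set S, A ⊆ C ∧ B ⊆ C ∧ Disjoint A B ∧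
      X.AlmostClosed m A ∧ X.AlmostClosed m B

/-- A Blackwell decomposition for the `m`-step chain `X^(m)`: a countable
collection of pairwise disjoint almost closed sets, all atomic except at most
one, where a nonatomic member contains no atomic subsets and consists of
transient states, and such that the probabilities `μ(L^(m)(C))` sum to one. -/
structure IsBlackwell (X : MarkovChain S) (m : ℕ) (𝒞 : Set (Set S)) : Prop where
  countable : 𝒞.Countable
  almostClosed : ∀ C ∈ 𝒞, X.AlmostClosed m C
  disjoint : 𝒞.PairwiseDisjoint id
  atMostOneNonatomic : ∀ C₁ ∈ 𝒞, ∀ C₂ ∈ 𝒞, ¬ X.Atomic m C₁ → ¬ X.Atomic m C₂ → C₁ = C₂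
  nonatomicNoAtomicSubset : ∀ C ∈ 𝒞, ¬ X.Atomic m C → ∀ A : Set S, A ⊆ C → ¬ X.Atomic m A
  nonatomicTransientStates : ∀ C ∈ 𝒞, ¬ X.Atomic m C → ∀ i ∈ C, X.Transient m {i}
  sum_L_eq_one : ∑' C : 𝒞, X.μ (X.L m (C : Set S)) = 1

/-- `β(X^(m))`: the number of sets in a Blackwell decomposition for `X^(m)`
(well defined since the decomposition is unique up to equivalence). -/
noncomputable def beta (X : MarkovChain S) (m : ℕ) : ℕ∞ :=
  sInf (Set.encard '' {𝒞 : Set (Set S) | X.IsBlackwell m 𝒞})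

/-- `X` is simple if `β(X) = 1`. -/
def Simple (X : MarkovChain S) : Prop := X.beta 1 = 1

/-- The asymptotic period `d(X) = sup {m ≥ 1 | β(X^(m)) = m}` (possibly `∞`). -/
noncomputable def period (X : MarkovChain S) : ℕ∞ :=
  sSup {d : ℕ∞ | ∃ m : ℕ, 1 ≤ m ∧ X.beta m = (m : ℕ∞) ∧ d = (m : ℕ∞)}

/-- Recurrence: every state is visited infinitely often almost surely. -/
def Recurrent (X : MarkovChain S) : Prop := ∀ i : S, X.μ (X.U 1 {i}) = 1

end MarkovChain

/-- The shift operator `θ` on path space: `(θ ω)(n) = ω(n+1)`. -/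
def pathShift {S : Type} : (ℕ → S) → ℕ → S := fun ω n => ω (n + 1)

/-- An event `E` is `m`-invariant if its indicator function `f` satisfies
`f(ω) = f(θ^m ω)` for all paths `ω`. -/
def MInvariant {S : Type} (m : ℕ) (E : Set (ℕ → S)) : Prop :=
  ∀ ω : ℕ → S, ω ∈ E ↔ pathShift^[m] ω ∈ E

/-- A birth-death process: a Markov chain on `ℕ` with positive birth
probabilities `p_i = P(i,i+1)`, positive death probabilities `q_{i+1} = P(i+1,i)`,
all transition probabilities other than `p_i`, `q_i` and `r_i = P(i,i)` zero,
and at least one positive self-transition probability. -/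
structure MarkovChain.IsBirthDeath (X : MarkovChain ℕ) : Prop where
  birth_pos : ∀ i : ℕ, 0 < X.P i (i + 1)
  death_pos : ∀ i : ℕ, 0 < X.P (i + 1) i
  tridiagonal : ∀ i j : ℕ, 1 < |(i : ℤ) - (j : ℤ)| → X.P i j = 0
  self_pos : ∃ i : ℕ, 0 < X.P i i

/-- The set of paths that agree with `s` up to time `n`. -/
def pathCylinder {S : Type} (n : ℕ) (s : ℕ → S) : Set (ℕ → S) := {ω | ∀ k ≤ n, ω k = s k}

/-- The path seen from time `n` onwards. -/
def pathTail {S : Type} (n : ℕ) (ω : ℕ → S) : ℕ → S := fun k => ω (n + k)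

section Markov

/-- Singletons of initial segments pull back to cylinders. -/
lemma exists_restrictLe_preimage_singleton_eq {S : Type} [Nonempty S] (n : ℕ) (x : Iic n → S) :
    ∃ s : ℕ → S, Preorder.restrictLe (π := fun _ : ℕ => S) n ⁻¹' {x} = pathCylinder n s := by
  classical
  refine ⟨fun k => if h : k ≤ n then x ⟨k, h⟩ else Classical.arbitrary S, ?_⟩
  ext ω
  simp only [mem_preimage, mem_singleton_iff, pathCylinder, mem_ofPred_eq]
  constructor
  · rintro rfl k hk
    simp [hk]
  · intro h
    ext ⟨k, hk⟩
    have := h k hk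
    simp only [mem_Iic] at hk
    simpa [hk] using this

variable {S : Type} [MeasurableSpace S]

lemma measurable_pathTail (n : ℕ) : Measurable (pathTail n : (ℕ → S) → ℕ → S) :=
  measurable_pi_lambda _ fun k => measurable_pi_apply (n + k)

lemma measurableSet_pathCylinder [MeasurableSingletonClass S] (n : ℕ) (s : ℕ → S) :
    MeasurableSet (pathCylinder n s) := by
  have : pathCylinder n s = ⋂ k, ⋂ (_ : k ≤ n), (fun ω : ℕ → S => ω k) ⁻¹' {s k} := by
    ext ω; simp [pathCylinder]
  rw [this]
  exact MeasurableSet.iInter fun k => MeasurableSet.iInter fun _ =>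
    measurable_pi_apply k (measurableSet_singleton _)

lemma iSup_piLE_eq : ⨆ n, Filtration.piLE (X := fun _ : ℕ => S) n = MeasurableSpace.pi := by
  refine le_antisymm (iSup_le fun n => (Filtration.piLE (X := fun _ : ℕ => S)).le n) ?_
  refine iSup_le fun n => le_trans ?_ (le_iSup _ n)
  rintro _ ⟨B, hB, rfl⟩
  exact ⟨(fun x : Iic n → S => x ⟨n, mem_Iic.2 le_rfl⟩) ⁻¹' B,
    measurable_pi_apply (⟨n, mem_Iic.2 le_rfl⟩ : Iic n) hB, rfl⟩

lemma measurable_piLE_apply (n : ℕ) :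
    Measurable[Filtration.piLE (X := fun _ : ℕ => S) n] (fun ω : ℕ → S => ω n) := by
  intro B hB
  exact ⟨(fun x : Iic n → S => x ⟨n, mem_Iic.2 le_rfl⟩) ⁻¹' B,
    measurable_pi_apply (⟨n, mem_Iic.2 le_rfl⟩ : Iic n) hB, rfl⟩

namespace MarkovChain

lemma nonempty_state (X : MarkovChain S) : Nonempty S := by
  by_contra h
  rw [not_nonempty_iff] at h
  have := X.init_hasSum.unique hasSum_empty
  norm_num at this

open Classical in
lemma measure_pathCylinder_inter (X : MarkovChain S) (n : ℕ) (s : ℕ → S) (N : ℕ) (t : ℕ → S) :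
    X.μ (pathCylinder n s ∩ pathTail n ⁻¹' pathCylinder N t) =
      X.μ (pathCylinder n s) * if t 0 = s n then
        ENNReal.ofReal (∏ k ∈ Finset.range N, X.P (t k) (t (k + 1))) else 0 := by
  split_ifs with h
  · set u : ℕ → S := fun k => if k ≤ n then s k else t (k - n) with hu
    have hun : ∀ k, u (n + k) = t k := by
      intro k
      rcases Nat.eq_zero_or_pos k with rfl | hk
      · simp [hu, h]
      · simp [hu, hk.ne']
    have hus : ∀ k ≤ n, u k = s k := fun k hk => by simp [hu, hk]
    have hset : pathCylinder n s ∩ pathTail n ⁻¹' pathCylinder N t = pathCylinder (n + N) u := by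
      ext ω
      simp only [mem_inter_iff, pathCylinder, mem_preimage, mem_ofPred_eq, pathTail]
      constructor
      · rintro ⟨h1, h2⟩ k hk
        rcases le_total k n with hkn | hkn
        · rw [hus k hkn, h1 k hkn]
        · obtain ⟨j, rfl⟩ := Nat.exists_eq_add_of_le hkn
          rw [hun, h2 j (by omega)]
      · intro h'
        exact ⟨fun k hk => by rw [h' k (by omega), hus k hk],
          fun k hk => by rw [h' (n + k) (by omega), hun]⟩
    rw [hset]
    unfold pathCylinder
    rw [X.μ_cylinder, X.μ_cylinder, ← ENNReal.ofReal_mul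
      (mul_nonneg (X.init_nonneg _) (Finset.prod_nonneg fun _ _ => X.P_nonneg _ _)),
      Finset.prod_range_add, hus 0 (Nat.zero_le _), mul_assoc]
    congr 3
    · exact Finset.prod_congr rfl fun k hk => by
        rw [Finset.mem_range] at hk; rw [hus k hk.le, hus (k + 1) hk]
    · exact Finset.prod_congr rfl fun k _ => by rw [add_assoc, hun, hun]
  · rw [mul_zero]
    convert measure_empty (μ := X.μ)
    rw [eq_empty_iff_forall_notMem]
    rintro ω ⟨h1, h2⟩
    exact h ((h2 0 (Nat.zero_le _)).symm.trans (h1 n le_rfl))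

open Classical in
/-- A family of laws of the chain with transition matrix `X.P` started from each state. -/
structure IsMarkovFamily (X : MarkovChain S) (Q : S → Measure (ℕ → S)) : Prop where
  prob : ∀ i, IsProbabilityMeasure (Q i)
  cylinder : ∀ i n s, Q i (pathCylinder n s) =
    if s 0 = i then ENNReal.ofReal (∏ k ∈ Finset.range n, X.P (s k) (s (k + 1))) else 0

/-- The laws started from each state exist, by conditioning, if every state can be reached. -/
lemma exists_isMarkovFamily [MeasurableSingletonClass S] (X : MarkovChain S)
    (h : ∀ i, ∃ n s, s n = i ∧ X.μ (pathCylinder n s) ≠ 0) :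
    ∃ Q, X.IsMarkovFamily Q := by
  have := X.μ_prob
  choose n s hs hpos using h
  refine ⟨fun i => (cond X.μ (pathCylinder (n i) (s i))).map (pathTail (n i)), ?_, ?_⟩
  · intro i
    have := cond_isProbabilityMeasure (hpos i)
    exact Measure.isProbabilityMeasure_map (measurable_pathTail _).aemeasurable
  · intro i N t
    rw [Measure.map_apply (measurable_pathTail _) (measurableSet_pathCylinder _ _),
      cond_apply (measurableSet_pathCylinder _ _), measure_pathCylinder_inter, hs, ← mul_assoc,
      ENNReal.inv_mul_cancel (hpos i) (measure_ne_top _ _), one_mul]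

end MarkovChain

variable [Countable S] [MeasurableSingletonClass S]

/-- Two finite measures agree on events depending on the first `n` coordinates as soon as they
agree on cylinders of length `n`. -/
lemma measure_eq_of_pathCylinder_of_piLE [Nonempty S] {μ ν : Measure (ℕ → S)} (n : ℕ)
    (h : ∀ s, μ (pathCylinder n s) = ν (pathCylinder n s)) {A : Set (ℕ → S)}
    (hA : MeasurableSet[Filtration.piLE (X := fun _ : ℕ => S) n] A) : μ A = ν A := by
  have hm : Measurable (Preorder.restrictLe (π := fun _ : ℕ => S) n) :=
    Preorder.measurable_restrictLe n
  have hmap : μ.map (Preorder.restrictLe (π := fun _ : ℕ => S) n) =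
      ν.map (Preorder.restrictLe (π := fun _ : ℕ => S) n) := by
    refine Measure.ext_of_singleton fun x => ?_
    obtain ⟨s, hs⟩ := exists_restrictLe_preimage_singleton_eq n x
    rw [Measure.map_apply hm (measurableSet_singleton _),
      Measure.map_apply hm (measurableSet_singleton _), hs, h]
  obtain ⟨B, hB, rfl⟩ := hA
  rw [← Measure.map_apply hm hB, ← Measure.map_apply hm hB, hmap]

/-- A finite measure on path space is determined by its values on cylinders. -/
lemma measure_ext_of_pathCylinder [Nonempty S] {μ ν : Measure (ℕ → S)} [IsFiniteMeasure μ]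
    [IsFiniteMeasure ν] (h : ∀ n s, μ (pathCylinder n s) = ν (pathCylinder n s)) : μ = ν := by
  refine ext_of_generate_finite {A | ∃ n, MeasurableSet[Filtration.piLE (X := fun _ : ℕ => S) n] A}
    ?_ ?_ ?_ ?_
  · rw [ofPred_exists]
    exact iSup_piLE_eq.symm.trans (MeasurableSpace.generateFrom_iUnion_measurableSet _).symm
  · rintro A ⟨n, hA⟩ B ⟨m, hB⟩ _
    exact ⟨max n m, ((Filtration.piLE (X := fun _ : ℕ => S)).mono (le_max_left n m) _ hA).inter
      ((Filtration.piLE (X := fun _ : ℕ => S)).mono (le_max_right n m) _ hB)⟩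
  · rintro A ⟨n, hA⟩
    exact measure_eq_of_pathCylinder_of_piLE n (h n) hA
  · exact measure_eq_of_pathCylinder_of_piLE 0 (h 0) MeasurableSet.univ

namespace MarkovChain

variable {X : MarkovChain S} {Q : S → Measure (ℕ → S)}

lemma IsMarkovFamily.measure_pathCylinder_inter (hQ : X.IsMarkovFamily Q) (n : ℕ) (s : ℕ → S)
    {B : Set (ℕ → S)} (hB : MeasurableSet B) :
    X.μ (pathCylinder n s ∩ pathTail n ⁻¹' B) = X.μ (pathCylinder n s) * Q (s n) B := by
  classical
  have := X.μ_prob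
  have := hQ.prob
  have := X.nonempty_state
  have hfin : IsFiniteMeasure (X.μ (pathCylinder n s) • Q (s n)) :=
    Measure.smul_finite _ (measure_ne_top _ _)
  have key : (X.μ.restrict (pathCylinder n s)).map (pathTail n) =
      X.μ (pathCylinder n s) • Q (s n) := by
    refine measure_ext_of_pathCylinder fun N t => ?_
    rw [Measure.map_apply (measurable_pathTail _) (measurableSet_pathCylinder _ _),
      Measure.restrict_apply (measurable_pathTail _ (measurableSet_pathCylinder _ _)), inter_comm,
      X.measure_pathCylinder_inter, Measure.smul_apply, hQ.cylinder, smul_eq_mul]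
  have := congrArg (fun ν : Measure (ℕ → S) => ν B) key
  simpa [Measure.map_apply (measurable_pathTail _) hB,
    Measure.restrict_apply (measurable_pathTail _ hB), inter_comm] using this

/-- The Markov property at time `n`. -/
lemma IsMarkovFamily.measure_inter_eq_setLIntegral (hQ : X.IsMarkovFamily Q) (n : ℕ)
    {A B : Set (ℕ → S)} (hA : MeasurableSet[Filtration.piLE (X := fun _ : ℕ => S) n] A)
    (hB : MeasurableSet B) :
    X.μ (A ∩ pathTail n ⁻¹' B) = ∫⁻ ω in A, Q (ω n) B ∂X.μ := by
  have := X.nonempty_state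
  have hA' : MeasurableSet A := (Filtration.piLE (X := fun _ : ℕ => S)).le n _ hA
  have hB' := measurable_pathTail (S := S) n hB
  rw [← Measure.restrict_apply' hB', ← withDensity_apply _ hA']
  refine measure_eq_of_pathCylinder_of_piLE n (fun s => ?_) hA
  have hC := measurableSet_pathCylinder n s
  rw [withDensity_apply _ hC, Measure.restrict_apply' hB', hQ.measure_pathCylinder_inter n s hB,
    setLIntegral_congr_fun hC (g := fun _ => Q (s n) B), setLIntegral_const, mul_comm]
  intro ω hω
  simp only [hω n le_rfl]

lemma IsMarkovFamily.measure_apply_eq_inter (hQ : X.IsMarkovFamily Q) (n : ℕ) (i : S)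
    {B : Set (ℕ → S)} (hB : MeasurableSet B) :
    X.μ ({ω | ω n = i} ∩ pathTail n ⁻¹' B) = X.μ {ω | ω n = i} * Q i B := by
  have hA : MeasurableSet[Filtration.piLE (X := fun _ : ℕ => S) n] {ω : ℕ → S | ω n = i} :=
    measurable_piLE_apply n (measurableSet_singleton i)
  rw [hQ.measure_inter_eq_setLIntegral n hA hB, setLIntegral_congr_fun
    ((Filtration.piLE (X := fun _ : ℕ => S)).le n _ hA) (g := fun _ => Q i B), setLIntegral_const,
    mul_comm]
  intro ω hω
  simp only [show ω n = i from hω]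

/-- The Markov property at time `n`, in terms of conditional expectations. -/
lemma IsMarkovFamily.condExp_ae_eq (hQ : X.IsMarkovFamily Q) (n : ℕ)
    {B : Set (ℕ → S)} (hB : MeasurableSet B) :
    X.μ[(pathTail n ⁻¹' B).indicator (1 : (ℕ → S) → ℝ) | Filtration.piLE (X := fun _ : ℕ => S) n]
      =ᵐ[X.μ] fun ω => (Q (ω n)).real B := by
  have := X.μ_prob
  have := hQ.prob
  have hB' := measurable_pathTail (S := S) n hB
  have hle := (Filtration.piLE (X := fun _ : ℕ => S)).le n
  have hmeas : Measurable[Filtration.piLE (X := fun _ : ℕ => S) n]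
      (fun ω : ℕ → S => (Q (ω n)).real B) :=
    (measurable_of_countable fun i => (Q i).real B).comp (measurable_piLE_apply n)
  have hintegrable : Integrable (fun ω : ℕ → S => (Q (ω n)).real B) X.μ :=
    Integrable.of_bound (C := 1) (hmeas.mono hle le_rfl).aestronglyMeasurable
      (ae_of_all _ fun ω => by simp [abs_of_nonneg, measureReal_nonneg, measureReal_le_one])
  symm
  refine ae_eq_condExp_of_forall_setIntegral_eq hle ?_ (fun s _ _ => hintegrable.integrableOn) ?_
    hmeas.stronglyMeasurable.aestronglyMeasurable
  · exact (integrable_const (1 : ℝ)).indicator hB'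
  · intro A hA _
    have hA' : MeasurableSet A := hle _ hA
    have h1 : ∫ ω in A, (pathTail n ⁻¹' B).indicator (1 : (ℕ → S) → ℝ) ω ∂X.μ =
        X.μ.real (A ∩ pathTail n ⁻¹' B) := by
      rw [integral_indicator_one hB', measureReal_restrict_apply hB', inter_comm]
    rw [h1, measureReal_def, hQ.measure_inter_eq_setLIntegral n hA hB]
    simp only [measureReal_def]
    rw [integral_toReal]
    · exact ((measurable_of_countable fun i => Q i B).comp (measurable_pi_apply n)).aemeasurable
    · exact ae_of_all _ fun ω => measure_lt_top _ _

/-- Lévy's zero-one law: the conditional probabilities of an event converge to its indicator. -/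
lemma IsMarkovFamily.ae_tendsto (hQ : X.IsMarkovFamily Q) {E : Set (ℕ → S)} {B : ℕ → Set (ℕ → S)}
    (hB : ∀ n, MeasurableSet (B n)) (hE : ∀ n, E = pathTail n ⁻¹' B n) :
    ∀ᵐ ω ∂X.μ, Tendsto (fun n => (Q (ω n)).real (B n)) atTop
      (nhds (E.indicator (1 : (ℕ → S) → ℝ) ω)) := by
  have := X.μ_prob
  have h := tendsto_ae_condExp (μ := X.μ) (ℱ := Filtration.piLE (X := fun _ : ℕ => S))
    (E.indicator (1 : (ℕ → S) → ℝ))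
  have hmE : MeasurableSet E := hE 0 ▸ measurable_pathTail 0 (hB 0)
  rw [iSup_piLE_eq, condExp_of_stronglyMeasurable le_rfl
    (stronglyMeasurable_one.indicator hmE) ((integrable_const (1 : ℝ)).indicator hmE)] at h
  have h2 : ∀ᵐ ω ∂X.μ, ∀ n, (X.μ[E.indicator (1 : (ℕ → S) → ℝ) |
      Filtration.piLE (X := fun _ : ℕ => S) n]) ω = (Q (ω n)).real (B n) := by
    rw [ae_all_iff]
    intro n
    have := hQ.condExp_ae_eq n (hB n)
    rw [← hE n] at this
    exact this
  filter_upwards [h, h2] with ω h1 h2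
  exact h1.congr h2

end MarkovChain

end Markov

namespace MarkovChain

lemma P_le_one {S : Type} [MeasurableSpace S] (X : MarkovChain S) (i j : S) : X.P i j ≤ 1 :=
  le_hasSum (X.P_stochastic i) j fun k _ => X.P_nonneg i k

variable {X : MarkovChain ℕ} {Q : ℕ → Measure (ℕ → ℕ)}

lemma IsBirthDeath.exists_pathCylinder_ne_zero (hbd : X.IsBirthDeath) (i : ℕ) :
    ∃ n s, s n = i ∧ X.μ (pathCylinder n s) ≠ 0 := by
  have step : ∀ i j, 0 < X.P i j → (∃ n s, s n = i ∧ X.μ (pathCylinder n s) ≠ 0) →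
      ∃ n s, s n = j ∧ X.μ (pathCylinder n s) ≠ 0 := by
    rintro i j hij ⟨n, s, rfl, hs⟩
    refine ⟨n + 1, Function.update s (n + 1) j, by simp, ?_⟩
    unfold pathCylinder at hs ⊢
    rw [X.μ_cylinder, ← pos_iff_ne_zero, ENNReal.ofReal_pos] at hs ⊢
    rw [Finset.prod_range_succ, ← mul_assoc]
    refine mul_pos ?_ ?_
    · rw [Function.update_of_ne (by omega), Finset.prod_congr rfl fun k hk => ?_]
      · exact hs
      · rw [Finset.mem_range] at hk
        rw [Function.update_of_ne (by omega), Function.update_of_ne (by omega)]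
    · simpa using hij
  obtain ⟨a, ha⟩ : ∃ a, 0 < X.init a := by
    by_contra! h
    have h0 : X.init = fun _ => 0 := funext fun a => le_antisymm (h a) (X.init_nonneg a)
    have := X.init_hasSum.unique (h0 ▸ hasSum_zero)
    norm_num at this
  have base : ∃ n s, s n = a ∧ X.μ (pathCylinder n s) ≠ 0 := by
    refine ⟨0, fun _ => a, rfl, ?_⟩
    unfold pathCylinder
    rw [X.μ_cylinder]
    simpa using ha
  have zero : ∃ n s, s n = 0 ∧ X.μ (pathCylinder n s) ≠ 0 := by
    clear ha
    induction a with
    | zero => exact base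
    | succ a ih => exact ih (step _ _ (hbd.death_pos a) base)
  induction i with
  | zero => exact zero
  | succ i ih => exact step _ _ (hbd.birth_pos i) ih

lemma IsMarkovFamily.measure_step (hQ : X.IsMarkovFamily Q) (n i j : ℕ) :
    X.μ {ω | ω n = i ∧ ω (n + 1) = j} = X.μ {ω | ω n = i} * ENNReal.ofReal (X.P i j) := by
  have h := hQ.measure_apply_eq_inter n i
    (measurableSet_pathCylinder 1 (fun k => if k = 0 then i else j))
  rw [hQ.cylinder] at h
  simp only [if_true, Finset.range_one, Finset.prod_singleton, zero_add, one_ne_zero,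
    if_false] at h
  rw [← h]
  congr 1
  ext ω
  simp only [pathCylinder, pathTail, mem_ofPred_eq, mem_inter_iff, mem_preimage]
  constructor
  · rintro ⟨h1, h2⟩
    refine ⟨h1, fun k hk => ?_⟩
    interval_cases k <;> simp [h1, h2]
  · rintro ⟨h1, h2⟩
    exact ⟨h1, by simpa using h2 1 le_rfl⟩

/-- The chain almost surely only makes transitions of positive probability. -/
lemma IsMarkovFamily.ae_P_ne_zero (hQ : X.IsMarkovFamily Q) :
    ∀ᵐ ω ∂X.μ, ∀ n, X.P (ω n) (ω (n + 1)) ≠ 0 := by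
  have : ∀ᵐ ω ∂X.μ, ∀ n i j, X.P i j = 0 → ¬ (ω n = i ∧ ω (n + 1) = j) := by
    simp only [ae_all_iff]
    intro n i j hij
    have := hQ.measure_step n i j
    rw [hij, ENNReal.ofReal_zero, mul_zero] at this
    rw [ae_iff]
    simpa using this
  filter_upwards [this] with ω h n h0
  exact h n _ _ h0 ⟨rfl, rfl⟩

/-- Almost surely, whenever a state is visited infinitely often, so is the state above it. -/
lemma IsMarkovFamily.ae_frequently_succ (hQ : X.IsMarkovFamily Q) (hbd : X.IsBirthDeath) :
    ∀ᵐ ω ∂X.μ, ∀ i, (∃ᶠ n in atTop, ω n = i) → ∃ᶠ n in atTop, ω n = i + 1 := by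
  have := X.μ_prob
  have := hQ.prob
  rw [ae_all_iff]
  intro i
  have hmeas : MeasurableSet {t : ℕ → ℕ | t 1 = i + 1} :=
    measurable_pi_apply 1 (measurableSet_singleton _)
  have hcond : ∀ᵐ ω ∂X.μ, ∀ n, (X.μ[({ω | ω (n + 1) = i + 1} : Set (ℕ → ℕ)).indicator
      (1 : (ℕ → ℕ) → ℝ) | Filtration.piLE (X := fun _ : ℕ => ℕ) n]) ω =
        (Q (ω n)).real {t | t 1 = i + 1} := by
    rw [ae_all_iff]
    exact fun n => hQ.condExp_ae_eq n hmeas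
  have hle : X.P i (i + 1) ≤ (Q i).real {t | t 1 = i + 1} := by
    have h1 : (Q i) (pathCylinder 1 (fun k => if k = 0 then i else i + 1)) =
        ENNReal.ofReal (X.P i (i + 1)) := by
      rw [hQ.cylinder]; simp
    rw [← ENNReal.toReal_ofReal (X.P_nonneg i (i + 1)), ← h1]
    exact measureReal_mono fun t ht => by simpa using ht 1 le_rfl
  filter_upwards [hcond, ae_mem_limsup_atTop_iff (μ := X.μ)
    (ℱ := Filtration.piLE (X := fun _ : ℕ => ℕ)) (s := fun n => {ω | ω n = i + 1})
    fun n => measurable_piLE_apply n (measurableSet_singleton _)] with ω h1 h2 hfreq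
  rw [mem_limsup_iff_frequently_mem] at h2
  refine h2.2 ?_
  simp only [h1]
  rw [← not_summable_iff_tendsto_nat_atTop_of_nonneg fun _ => measureReal_nonneg]
  intro hsum
  have hev := hsum.tendsto_atTop_zero.eventually (gt_mem_nhds (hbd.birth_pos i))
  obtain ⟨n, hn, hn'⟩ := (hfreq.and_eventually hev).exists
  rw [hn] at hn'
  exact absurd hn' (not_lt.2 hle)

lemma IsMarkovFamily.ae_unbounded (hQ : X.IsMarkovFamily Q) (hbd : X.IsBirthDeath) :
    ∀ᵐ ω ∂X.μ, ∀ K, ∃ n, K < ω n := by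
  filter_upwards [hQ.ae_frequently_succ hbd] with ω hω K
  by_contra! hK
  obtain ⟨i, hi⟩ : ∃ i, ∃ᶠ n in atTop, ω n = i := by
    by_contra! h
    have := (finite_Iic K).eventually_all (l := atTop) (p := fun i n => ω n ≠ i)
    obtain ⟨n, hn⟩ := (this.2 fun i _ => h i).exists
    exact hn (ω n) (hK n) rfl
  have hall : ∀ k, ∃ᶠ n in atTop, ω n = i + k := by
    intro k
    induction k with
    | zero => exact hi
    | succ k ih => exact hω _ ih
  obtain ⟨n, hn⟩ := (hall (K + 1)).exists
  have := hK n
  omega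

/-- The path that starts at `i` and moves up at every step. -/
def risingPath (i : ℕ) : Set (ℕ → ℕ) := {t | ∀ k, t k = i + k}

lemma measurableSet_risingPath (i : ℕ) : MeasurableSet (risingPath i) := by
  have : risingPath i = ⋂ N, pathCylinder N (fun k => i + k) := by
    ext t
    simp only [risingPath, pathCylinder, mem_ofPred_eq, mem_iInter]
    exact ⟨fun h _ k _ => h k, fun h k => h k k le_rfl⟩
  rw [this]
  exact MeasurableSet.iInter fun N => measurableSet_pathCylinder _ _

lemma IsMarkovFamily.tendsto_risingPath (hQ : X.IsMarkovFamily Q) (i : ℕ) :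
    Tendsto (fun N => ENNReal.ofReal (∏ k ∈ Finset.range N, X.P (i + k) (i + k + 1))) atTop
      (nhds (Q i (risingPath i))) := by
  have := hQ.prob
  have heq : risingPath i = ⋂ N, pathCylinder N (fun k => i + k) := by
    ext t
    simp only [risingPath, pathCylinder, mem_ofPred_eq, mem_iInter]
    exact ⟨fun h _ k _ => h k, fun h k => h k k le_rfl⟩
  have h := tendsto_measure_iInter_atTop (μ := Q i) (s := fun N => pathCylinder N (fun k => i + k))
    (fun N => (measurableSet_pathCylinder _ _).nullMeasurableSet)
    (fun N M hNM t ht k hk => ht k (hk.trans hNM)) ⟨0, measure_ne_top _ _⟩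
  rw [← heq] at h
  refine h.congr fun N => ?_
  rw [Function.comp_apply, hQ.cylinder]
  simp [add_assoc]

lemma prod_birth_antitone (X : MarkovChain ℕ) :
    Antitone fun n => ∏ i ∈ Finset.range n, X.P i (i + 1) :=
  antitone_nat_of_succ_le fun n => by
    rw [Finset.prod_range_succ]
    exact mul_le_of_le_one_right (Finset.prod_nonneg fun _ _ => X.P_nonneg _ _) (X.P_le_one _ _)

lemma IsBirthDeath.prod_pos (hbd : X.IsBirthDeath) (n : ℕ) :
    0 < ∏ i ∈ Finset.range n, X.P i (i + 1) :=
  Finset.prod_pos fun i _ => hbd.birth_pos i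

lemma IsMarkovFamily.risingPath_eq_zero (hQ : X.IsMarkovFamily Q) (hbd : X.IsBirthDeath)
    (h : Tendsto (fun n => ∏ i ∈ Finset.range n, X.P i (i + 1)) atTop (nhds 0)) (i : ℕ) :
    Q i (risingPath i) = 0 := by
  refine tendsto_nhds_unique (hQ.tendsto_risingPath i) ?_
  have h1 := ((tendsto_add_atTop_iff_nat i).2 h).div_const (∏ k ∈ Finset.range i, X.P k (k + 1))
  rw [zero_div] at h1
  have h2 := ENNReal.tendsto_ofReal h1
  rw [ENNReal.ofReal_zero] at h2
  refine h2.congr fun N => ?_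
  rw [add_comm, Finset.prod_range_add, mul_div_cancel_left₀ _ (hbd.prod_pos i).ne']

lemma IsMarkovFamily.le_risingPath (hQ : X.IsMarkovFamily Q) {c : ℝ}
    (h : Tendsto (fun n => ∏ i ∈ Finset.range n, X.P i (i + 1)) atTop (nhds c)) (i : ℕ) :
    ENNReal.ofReal c ≤ Q i (risingPath i) := by
  refine ge_of_tendsto' (hQ.tendsto_risingPath i) fun N => ENNReal.ofReal_le_ofReal ?_
  refine (X.prod_birth_antitone.le_of_tendsto h (i + N)).trans ?_
  rw [Finset.prod_range_add]
  exact mul_le_of_le_one_left (Finset.prod_nonneg fun _ _ => X.P_nonneg _ _)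
    (Finset.prod_le_one (fun _ _ => X.P_nonneg _ _) fun _ _ => X.P_le_one _ _)

/-- If the product of the birth probabilities vanishes, the chain does not eventually move up at
every step. -/
lemma IsMarkovFamily.ae_not_rising (hQ : X.IsMarkovFamily Q) (hbd : X.IsBirthDeath)
    (h : Tendsto (fun n => ∏ i ∈ Finset.range n, X.P i (i + 1)) atTop (nhds 0)) :
    ∀ᵐ ω ∂X.μ, ∀ n, ¬ ∀ k, ω (n + k) = ω n + k := by
  have : ∀ᵐ ω ∂X.μ, ∀ n i, ¬ (ω n = i ∧ pathTail n ω ∈ risingPath i) := by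
    simp only [ae_all_iff]
    intro n i
    have := hQ.measure_apply_eq_inter n i (measurableSet_risingPath i)
    rw [hQ.risingPath_eq_zero hbd h, mul_zero] at this
    rw [ae_iff]
    simp only [not_not]
    exact this
  filter_upwards [this] with ω hω n hn
  exact hω n _ ⟨rfl, hn⟩

end MarkovChain

/-- A path with bounded steps on `ℕ` that does not eventually move up at every step infinitely
often repeats its position after one or two steps. -/
lemma frequently_repeat_of_not_rising {ω : ℕ → ℕ} (hup : ∀ n, ω (n + 1) ≤ ω n + 1)
    (hdown : ∀ n, ω n ≤ ω (n + 1) + 1) (h : ∀ n, ¬ ∀ k, ω (n + k) = ω n + k) :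
    ∃ᶠ n in atTop, ω (n + 1) = ω n ∨ ω (n + 2) = ω n := by
  rw [frequently_atTop]
  by_contra! hN
  obtain ⟨N, hN⟩ := hN
  have hdn : ∀ n ≥ N, ω n = ω (n + 1) + 1 := by
    intro n hn
    by_contra hne
    refine h n fun k => ?_
    have : ω (n + k) = ω n + k ∧ ω (n + k + 1) = ω n + k + 1 := by
      induction k with
      | zero =>
        have h1 := (hN n hn).1
        have h2 := hup n
        have h3 := hdown n
        exact ⟨rfl, show ω (n + 1) = ω n + 1 by omega⟩
      | succ k ih =>
        have h0 := (hN (n + k) (by omega)).2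
        have h1 := (hN (n + k + 1) (by omega)).1
        have h3 := hup (n + k + 1)
        have h4 := hdown (n + k + 1)
        rw [show n + k + 1 + 1 = n + k + 2 from rfl] at h1 h3 h4
        rw [show n + (k + 1) = n + k + 1 from rfl, show n + k + 1 + 1 = n + k + 2 from rfl]
        omega
    exact this.1
  have hsum : ∀ k, ω (N + k) + k = ω N := by
    intro k
    induction k with
    | zero => rfl
    | succ k ih =>
      have := hdn (N + k) (by omega)
      rw [show N + (k + 1) = N + k + 1 from rfl]
      omega
  have := hsum (ω N + 1)
  omega

namespace MarkovChain

/-- The event that a path is eventually in `C` at the times congruent to `-t` modulo `m`. -/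
def phaseEvent (m : ℕ) (C : Set ℕ) (t : ℕ) : Set (ℕ → ℕ) :=
  {ω | ∃ N, ∀ l ≥ N, m ∣ l + t → ω l ∈ C}

lemma measurableSet_phaseEvent (m : ℕ) (C : Set ℕ) (t : ℕ) :
    MeasurableSet (phaseEvent m C t) := by
  have : phaseEvent m C t = ⋃ N : ℕ, ⋂ l : ℕ, ⋂ (_ : N ≤ l), ⋂ (_ : m ∣ l + t),
      (fun ω : ℕ → ℕ => ω l) ⁻¹' C := by
    ext ω; simp [phaseEvent]
  rw [this]
  exact MeasurableSet.iUnion fun N => MeasurableSet.iInter fun l => MeasurableSet.iInter fun _ =>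
    MeasurableSet.iInter fun _ => measurable_pi_apply l (MeasurableSet.of_discrete)

lemma phaseEvent_eq_preimage (m : ℕ) (C : Set ℕ) (t n : ℕ) :
    phaseEvent m C t = pathTail n ⁻¹' phaseEvent m C (t + n) := by
  ext ω
  simp only [phaseEvent, pathTail, mem_ofPred_eq, mem_preimage]
  constructor
  · rintro ⟨N, hN⟩
    refine ⟨N, fun l hl hd => hN (n + l) (by omega) ?_⟩
    convert hd using 1
    omega
  · rintro ⟨N, hN⟩
    refine ⟨n + N, fun l hl hd => ?_⟩
    obtain ⟨j, rfl⟩ := Nat.exists_eq_add_of_le (show n ≤ l by omega)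
    refine hN j (by omega) ?_
    convert hd using 1
    omega

variable {X : MarkovChain ℕ} {Q : ℕ → Measure (ℕ → ℕ)}

lemma L_eq_phaseEvent (X : MarkovChain ℕ) {m : ℕ} (hm : 0 < m) (C : Set ℕ) :
    X.L m C = phaseEvent m C 0 := by
  ext ω
  simp only [L, phaseEvent, mem_ofPred_eq, add_zero]
  constructor
  · rintro ⟨n, hn⟩
    refine ⟨n * m, ?_⟩
    rintro l hl ⟨k, rfl⟩
    rw [mul_comm]
    exact hn k (Nat.le_of_mul_le_mul_left (by linarith) hm)
  · rintro ⟨N, hN⟩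
    exact ⟨N, fun k hk => hN _ (hk.trans (Nat.le_mul_of_pos_right k hm)) (Nat.dvd_mul_left m k)⟩

lemma IsBirthDeath.P_eq_zero (hbd : X.IsBirthDeath) {i j : ℕ} (h : i + 1 < j ∨ j + 1 < i) :
    X.P i j = 0 := by
  refine hbd.tridiagonal i j ?_
  rw [lt_abs]
  omega

lemma IsMarkovFamily.ae_step (hQ : X.IsMarkovFamily Q) (hbd : X.IsBirthDeath) :
    ∀ᵐ ω ∂X.μ, ∀ n, ω (n + 1) ≤ ω n + 1 ∧ ω n ≤ ω (n + 1) + 1 := by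
  filter_upwards [hQ.ae_P_ne_zero] with ω hω n
  by_contra h
  exact hω n (hbd.P_eq_zero (by omega))

/-- If the product of the birth probabilities vanishes, a phase in which the chain is eventually
in `C` is almost surely followed by another one after one or two steps. -/
lemma IsMarkovFamily.ae_phaseEvent_add (hQ : X.IsMarkovFamily Q) (hbd : X.IsBirthDeath)
    (h : Tendsto (fun n => ∏ i ∈ Finset.range n, X.P i (i + 1)) atTop (nhds 0))
    (m : ℕ) (C : Set ℕ) :
    ∀ᵐ ω ∂X.μ, ∀ t, ω ∈ phaseEvent m C t →
      ω ∈ phaseEvent m C (t + 1) ∨ ω ∈ phaseEvent m C (t + 2) := by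
  have hlevy : ∀ᵐ ω ∂X.μ, ∀ t, Tendsto (fun n => (Q (ω n)).real (phaseEvent m C (t + n))) atTop
      (nhds ((phaseEvent m C t).indicator (1 : (ℕ → ℕ) → ℝ) ω)) :=
    ae_all_iff.2 fun t => hQ.ae_tendsto (fun n => measurableSet_phaseEvent m C (t + n))
      (phaseEvent_eq_preimage m C t)
  filter_upwards [hlevy, hQ.ae_step hbd, hQ.ae_not_rising hbd h] with ω hω hstep hrise t ht
  have key : ∀ d, (∃ᶠ n in atTop, ω (n + d) = ω n) → ω ∈ phaseEvent m C (t + d) := by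
    intro d hd
    by_contra hnot
    have h1 := hω t
    have h2 := hω (t + d)
    rw [indicator_of_mem ht] at h1
    rw [indicator_of_notMem hnot] at h2
    have e1 := ((tendsto_add_atTop_iff_nat d).2 h1).eventually
      (lt_mem_nhds (show (1 / 2 : ℝ) < 1 by norm_num))
    have e2 := h2.eventually (gt_mem_nhds (show (0 : ℝ) < 1 / 2 by norm_num))
    obtain ⟨n, hn, hn1, hn2⟩ := (hd.and_eventually (e1.and e2)).exists
    rw [hn, show t + (n + d) = t + d + n by omega] at hn1
    exact lt_asymm hn1 hn2
  have := frequently_repeat_of_not_rising (fun n => (hstep n).1) (fun n => (hstep n).2) hrise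
  rw [frequently_or_distrib] at this
  exact this.imp (key 1) (key 2)

/-- A set that an unbounded path eventually meets in a family of phases with gaps at most two
contains one of any two consecutive large states. -/
lemma mem_or_succ_mem_of_phaseEvent {ω : ℕ → ℕ} {m : ℕ} (hm : 0 < m) {C : Set ℕ}
    (hup : ∀ n, ω (n + 1) ≤ ω n + 1) (hunb : ∀ K, ∃ n, K < ω n)
    (hphase : ∀ t, ω ∈ phaseEvent m C t →
      ω ∈ phaseEvent m C (t + 1) ∨ ω ∈ phaseEvent m C (t + 2))
    (h0 : ω ∈ phaseEvent m C 0) : ∃ K, ∀ k ≥ K, k ∈ C ∨ k + 1 ∈ C := by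
  have hN : ∀ t, ∃ N, ω ∈ phaseEvent m C t → ∀ l ≥ N, m ∣ l + t → ω l ∈ C := by
    intro t
    by_cases ht : ω ∈ phaseEvent m C t
    · obtain ⟨N, hN⟩ := ht
      exact ⟨N, fun _ => hN⟩
    · exact ⟨0, fun h => absurd h ht⟩
  choose N hN using hN
  set M := (Finset.range m).sup N
  have hmod : ∀ t, ω ∈ phaseEvent m C t → ω ∈ phaseEvent m C (t % m) := by
    rintro t ⟨A, hA⟩
    refine ⟨A, fun l hl hd => hA l hl ?_⟩
    rw [Nat.dvd_iff_mod_eq_zero] at hd ⊢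
    rwa [Nat.add_mod, Nat.mod_mod, ← Nat.add_mod] at hd
  have hgood : ∀ l ≥ M, (∃ t, m ∣ l + t ∧ ω ∈ phaseEvent m C t) → ω l ∈ C := by
    rintro l hl ⟨t, hd, ht⟩
    refine hN (t % m) (hmod t ht) l
      (le_trans (Finset.le_sup (Finset.mem_range.2 (Nat.mod_lt t hm))) hl) ?_
    rw [Nat.dvd_iff_mod_eq_zero] at hd ⊢
    rwa [Nat.add_mod, Nat.mod_mod, ← Nat.add_mod]
  have hdesc : ∀ a j, (∃ t, m ∣ (a + j) + t ∧ ω ∈ phaseEvent m C t) →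
      (∃ t, m ∣ a + t ∧ ω ∈ phaseEvent m C t) ∨
        (∃ t, m ∣ (a + 1) + t ∧ ω ∈ phaseEvent m C t) := by
    intro a j
    induction j using Nat.strong_induction_on with
    | _ j ih =>
      rintro ⟨t, hd, ht⟩
      match j, ih, hd with
      | 0, _, hd => exact Or.inl ⟨t, hd, ht⟩
      | 1, _, hd => exact Or.inr ⟨t, hd, ht⟩
      | j + 2, ih, hd =>
        rcases hphase t ht with h | h
        · exact ih (j + 1) (by omega) ⟨t + 1, by convert hd using 1; omega, h⟩
        · exact ih j (by omega) ⟨t + 2, by convert hd using 1; omega, h⟩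
  have hpair : ∀ a ≥ M, ω a ∈ C ∨ ω (a + 1) ∈ C := by
    intro a ha
    have hle : a ≤ a * m := Nat.le_mul_of_pos_right a hm
    refine (hdesc a (a * m - a) ⟨0, ?_, h0⟩).imp (hgood a ha) (hgood (a + 1) (by omega))
    rw [Nat.add_sub_cancel' hle, add_zero]
    exact Nat.dvd_mul_left m a
  refine ⟨(Finset.range (M + 1)).sup ω, fun k hk => ?_⟩
  classical
  have hex := hunb k
  have hspec := Nat.find_spec hex
  have hmin : ∀ j < Nat.find hex, ω j ≤ k := fun j hj => not_lt.1 (Nat.find_min hex hj)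
  set n := Nat.find hex
  have hMn : M < n := by
    by_contra hle
    have : ω n ≤ k := le_trans (Finset.le_sup (Finset.mem_range.2 (by omega))) hk
    omega
  obtain ⟨a, ha⟩ : ∃ a, n = a + 1 := ⟨n - 1, by omega⟩
  have h1 := hmin a (by omega)
  have h2 := hup a
  rw [ha] at hspec
  have h3 : ω a = k := by omega
  have h4 : ω (a + 1) = k + 1 := by omega
  rw [← h3, show ω a + 1 = ω (a + 1) by omega]
  exact hpair a (by omega)

/-- If the product of the birth probabilities vanishes, no `m`-step chain has a Blackwell
decomposition into more than two sets. -/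
lemma IsMarkovFamily.encard_le_two (hQ : X.IsMarkovFamily Q) (hbd : X.IsBirthDeath)
    (h : Tendsto (fun n => ∏ i ∈ Finset.range n, X.P i (i + 1)) atTop (nhds 0))
    {m : ℕ} (hm : 0 < m) {𝒞 : Set (Set ℕ)} (h𝒞 : X.IsBlackwell m 𝒞) : 𝒞.encard ≤ 2 := by
  have hK : ∀ C ∈ 𝒞, ∃ K, ∀ k ≥ K, k ∈ C ∨ k + 1 ∈ C := by
    intro C hC
    obtain ⟨hreg, htrans⟩ := h𝒞.almostClosed C hC
    have hL : X.μ (X.L m C) ≠ 0 := fun h0 =>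
      htrans ((measure_congr (measure_symmDiff_eq_zero_iff.1 hreg)).trans h0)
    rw [L_eq_phaseEvent X hm] at hL
    obtain ⟨ω, h0, h1, h2, h3⟩ := ((frequently_ae_mem_iff.2 hL).and_eventually
      ((hQ.ae_step hbd).and ((hQ.ae_unbounded hbd).and (hQ.ae_phaseEvent_add hbd h m C)))).exists
    exact mem_or_succ_mem_of_phaseEvent hm (fun n => (h1 n).1) h2 h3 h0
  by_contra hcard
  rw [not_le] at hcard
  obtain ⟨T, hT, hT3⟩ := exists_subset_encard_eq (k := 3) (Order.add_one_le_of_lt hcard)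
  obtain ⟨A, B, C, hAB, hAC, hBC, rfl⟩ := encard_eq_three.1 hT3
  have hA : A ∈ 𝒞 := hT (by simp)
  have hB : B ∈ 𝒞 := hT (by simp)
  have hC : C ∈ 𝒞 := hT (by simp)
  have dAB : Disjoint A B := h𝒞.disjoint hA hB hAB
  have dAC : Disjoint A C := h𝒞.disjoint hA hC hAC
  have dBC : Disjoint B C := h𝒞.disjoint hB hC hBC
  rw [disjoint_left] at dAB dAC dBC
  obtain ⟨a, ha⟩ := hK A hA
  obtain ⟨b, hb⟩ := hK B hB
  obtain ⟨c, hc⟩ := hK C hC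
  have ha' := ha (a + b + c) (by omega)
  have hb' := hb (a + b + c) (by omega)
  have hc' := hc (a + b + c) (by omega)
  have := @dAB (a + b + c)
  have := @dAB (a + b + c + 1)
  have := @dAC (a + b + c)
  have := @dAC (a + b + c + 1)
  have := @dBC (a + b + c)
  have := @dBC (a + b + c + 1)
  tauto

lemma exists_tendsto_prod_birth_of_period_eq_top (hbd : X.IsBirthDeath) (hp : X.period = ⊤) :
    ∃ c : ℝ, 0 < c ∧ Tendsto (fun n => ∏ i ∈ Finset.range n, X.P i (i + 1)) atTop (nhds c) := by
  obtain ⟨Q, hQ⟩ := X.exists_isMarkovFamily hbd.exists_pathCylinder_ne_zero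
  have hbdd : BddBelow (range fun n => ∏ i ∈ Finset.range n, X.P i (i + 1)) :=
    ⟨0, by rintro _ ⟨n, rfl⟩; exact (hbd.prod_pos n).le⟩
  have hlim := tendsto_atTop_ciInf X.prod_birth_antitone hbdd
  refine ⟨_, ?_, hlim⟩
  refine lt_of_le_of_ne (le_ciInf fun n => (hbd.prod_pos n).le) fun h0 => ?_
  rw [← h0] at hlim
  have h2 : (2 : ℕ∞) < X.period := by rw [hp]; exact ENat.natCast_lt_top 2
  obtain ⟨_, ⟨m, hm, hbeta, rfl⟩, hlt⟩ := lt_sSup_iff.1 h2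
  have hne : (encard '' {𝒞 : Set (Set ℕ) | X.IsBlackwell m 𝒞}).Nonempty := by
    by_contra hemp
    rw [not_nonempty_iff_eq_empty] at hemp
    rw [beta, hemp, sInf_empty] at hbeta
    exact ENat.top_ne_natCast m hbeta
  obtain ⟨𝒞, h𝒞, hcard⟩ := csInf_mem hne
  have : X.beta m ≤ 2 := hcard.symm.le.trans (hQ.encard_le_two hbd hlim hm h𝒞)
  rw [hbeta] at this
  exact absurd hlt (not_lt.2 this)

end MarkovChain

namespace MarkovChain

/-- The event that the path eventually moves up at every step. -/
def eventuallyRising : Set (ℕ → ℕ) := {ω | ∃ n, ∀ k, ω (n + k) = ω n + k}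

/-- The states congruent to `r` modulo `m`. -/
def residueClass (m r : ℕ) : Set ℕ := {i | i % m = r}

lemma measurableSet_eventuallyRising : MeasurableSet eventuallyRising := by
  have : eventuallyRising = ⋃ n : ℕ, ⋂ k : ℕ, {ω : ℕ → ℕ | ω (n + k) = ω n + k} := by
    ext ω; simp [eventuallyRising]
  rw [this]
  refine MeasurableSet.iUnion fun n => MeasurableSet.iInter fun k => ?_
  exact measurableSet_eq_fun (measurable_pi_apply _) 
    ((measurable_of_countable fun x : ℕ => x + k).comp (measurable_pi_apply n))

lemma eventuallyRising_eq_preimage (n : ℕ) :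
    eventuallyRising = pathTail n ⁻¹' eventuallyRising := by
  ext ω
  simp only [eventuallyRising, pathTail, mem_preimage, mem_ofPred_eq]
  constructor
  · rintro ⟨N, hN⟩
    refine ⟨N, fun k => ?_⟩
    have h1 := hN (n + k)
    have h2 := hN n
    rw [show n + (N + k) = N + (n + k) by omega, show n + N = N + n by omega]
    omega
  · rintro ⟨N, hN⟩
    exact ⟨n + N, fun k => by rw [add_assoc]; exact hN k⟩

lemma exists_progression_of_mem_eventuallyRising {m : ℕ} (hm : 0 < m) {ω : ℕ → ℕ}
    (hω : ω ∈ eventuallyRising) : ∃ n a, ∀ j, ω ((n + j) * m) = a + j * m := by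
  obtain ⟨n, hn⟩ := hω
  have hle : n ≤ n * m := Nat.le_mul_of_pos_right n hm
  refine ⟨n, ω (n * m), fun j => ?_⟩
  have h1 := hn (n * m - n)
  have h2 := hn (n * m - n + j * m)
  rw [show n + (n * m - n) = n * m by omega] at h1
  rw [show n + (n * m - n + j * m) = (n + j) * m by rw [add_mul]; omega] at h2
  omega

variable {X : MarkovChain ℕ} {Q : ℕ → Measure (ℕ → ℕ)} {m : ℕ}

lemma L_subset_U (X : MarkovChain ℕ) (m : ℕ) (C : Set ℕ) : X.L m C ⊆ X.U m C := by
  rintro ω ⟨N, hN⟩ n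
  exact ⟨max n N, le_max_left _ _, hN _ (le_max_right _ _)⟩

lemma U_mono (X : MarkovChain ℕ) (m : ℕ) {C D : Set ℕ} (h : C ⊆ D) : X.U m C ⊆ X.U m D :=
  fun _ hω n => (hω n).imp fun _ hk => ⟨hk.1, h hk.2⟩

lemma L_inter (X : MarkovChain ℕ) (m : ℕ) (C D : Set ℕ) :
    X.L m (C ∩ D) = X.L m C ∩ X.L m D := by
  ext ω
  simp only [L, mem_ofPred_eq, mem_inter_iff, ← eventually_atTop, eventually_and]

lemma notMem_U_of_disjoint {ω : ℕ → ℕ} {C D : Set ℕ} (h : Disjoint C D) (hC : ω ∈ X.L m C) :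
    ω ∉ X.U m D := by
  obtain ⟨N, hN⟩ := hC
  intro hD
  obtain ⟨k, hk, hkD⟩ := hD N
  exact disjoint_left.1 h (hN k hk) hkD

lemma measurableSet_L (X : MarkovChain ℕ) (m : ℕ) (C : Set ℕ) : MeasurableSet (X.L m C) := by
  have : X.L m C = ⋃ N : ℕ, ⋂ k : ℕ, ⋂ (_ : N ≤ k), (fun ω : ℕ → ℕ => ω (k * m)) ⁻¹' C := by
    ext ω; simp [L]
  rw [this]
  exact MeasurableSet.iUnion fun N => MeasurableSet.iInter fun k => MeasurableSet.iInter fun _ =>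
    measurable_pi_apply _ (MeasurableSet.of_discrete)

lemma disjoint_residueClass {r s : ℕ} (h : r ≠ s) :
    Disjoint (residueClass m r) (residueClass m s) :=
  disjoint_left.2 fun _ hr hs => h (hr.symm.trans hs)

lemma exists_mem_L_residueClass (X : MarkovChain ℕ) (hm : 0 < m) {ω : ℕ → ℕ}
    (hω : ω ∈ eventuallyRising) : ∃ r < m, ω ∈ X.L m (residueClass m r) := by
  obtain ⟨n, a, ha⟩ := exists_progression_of_mem_eventuallyRising hm hω
  refine ⟨a % m, Nat.mod_lt a hm, n, fun k hk => ?_⟩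
  obtain ⟨j, rfl⟩ := Nat.exists_eq_add_of_le hk
  rw [ha]
  exact Nat.add_mul_mod_self_right a j m

lemma mem_U_iff_infinite (hm : 0 < m) {ω : ℕ → ℕ} (hω : ω ∈ eventuallyRising) {r : ℕ}
    (hr : ω ∈ X.L m (residueClass m r)) (A : Set ℕ) :
    ω ∈ X.U m A ↔ (A ∩ residueClass m r).Infinite := by
  obtain ⟨n, a, ha⟩ := exists_progression_of_mem_eventuallyRising hm hω
  have har : a % m = r := by
    obtain ⟨N, hN⟩ := hr
    have := hN (n + N) (by omega)
    rw [ha] at this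
    rw [← show (a + N * m) % m = r from this, Nat.add_mul_mod_self_right]
  constructor
  · intro hA
    refine infinite_of_forall_exists_gt fun x => ?_
    obtain ⟨k, hk, hkA⟩ := hA (n + (x + 1))
    obtain ⟨j, rfl⟩ := Nat.exists_eq_add_of_le (show n ≤ k by omega)
    rw [ha] at hkA
    refine ⟨a + j * m, ⟨hkA, ?_⟩, ?_⟩
    · rw [← har]
      exact Nat.add_mul_mod_self_right a j m
    · have := Nat.le_mul_of_pos_right j hm
      omega
  · intro hinf N
    obtain ⟨x, ⟨hxA, hxr⟩, hx⟩ := hinf.exists_gt (a + N * m)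
    have hmod : a ≡ x [MOD m] := har.trans (show x % m = r from hxr).symm
    obtain ⟨j, hj⟩ := (Nat.modEq_iff_dvd' (by omega)).1 hmod
    have hxj : x = a + j * m := by
      rw [mul_comm j m, ← hj]; omega
    refine ⟨n + j, ?_, by rwa [ha, ← hxj]⟩
    have : N * m < j * m := by omega
    have := Nat.lt_of_mul_lt_mul_right this
    omega

lemma regular_iff_ae (X : MarkovChain ℕ) (m : ℕ) (C : Set ℕ) :
    X.Regular m C ↔ ∀ᵐ ω ∂X.μ, ω ∈ X.U m C → ω ∈ X.L m C := by
  rw [Regular, symmDiff_of_ge (show X.L m C ≤ X.U m C from X.L_subset_U m C), ae_iff]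
  simp only [Classical.not_imp]
  rfl

/-- If the product of the birth probabilities is positive, the chain eventually moves up at every
step. -/
lemma IsMarkovFamily.ae_mem_eventuallyRising (hQ : X.IsMarkovFamily Q) {c : ℝ} (hc : 0 < c)
    (h : Tendsto (fun n => ∏ i ∈ Finset.range n, X.P i (i + 1)) atTop (nhds c)) :
    ∀ᵐ ω ∂X.μ, ω ∈ eventuallyRising := by
  have := hQ.prob
  filter_upwards [hQ.ae_tendsto (B := fun _ => eventuallyRising)
    (fun _ => measurableSet_eventuallyRising) eventuallyRising_eq_preimage] with ω hω
  by_contra hnot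
  rw [indicator_of_notMem hnot] at hω
  refine absurd (ge_of_tendsto' hω fun n => ?_) (not_le.2 hc)
  have h1 : ENNReal.ofReal c ≤ Q (ω n) eventuallyRising := by
    refine (hQ.le_risingPath h (ω n)).trans (measure_mono fun t ht => ⟨0, fun k => ?_⟩)
    rw [zero_add, ht k, ht 0, add_zero]
  exact (ENNReal.ofReal_le_iff_le_toReal (measure_ne_top _ _)).1 h1

lemma IsMarkovFamily.L_residueClass_ne_zero (hQ : X.IsMarkovFamily Q) (hbd : X.IsBirthDeath)
    {c : ℝ} (hc : 0 < c)
    (h : Tendsto (fun n => ∏ i ∈ Finset.range n, X.P i (i + 1)) atTop (nhds c))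
    (hm : 0 < m) {r : ℕ} (hr : r < m) : X.μ (X.L m (residueClass m r)) ≠ 0 := by
  obtain ⟨i, hi⟩ := hbd.self_pos
  obtain ⟨n, s, rfl, hs⟩ := hbd.exists_pathCylinder_ne_zero i
  have hvisit : ∀ t, X.μ {ω | ω (n + t) = s n} ≠ 0 := by
    intro t
    induction t with
    | zero => exact fun h0 => hs (measure_mono_null (fun ω hω => hω n le_rfl) h0)
    | succ t ih =>
      intro h0
      have h1 := hQ.measure_step (n + t) (s n) (s n)
      rw [measure_mono_null (fun ω hω => hω.2) h0] at h1
      exact mul_ne_zero ih (ENNReal.ofReal_pos.2 hi).ne' h1.symm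
  obtain ⟨t, ht⟩ : ∃ t, r + (n + t) = s n + (n + 1) * m := by
    have hle : n ≤ n * m := Nat.le_mul_of_pos_right n hm
    refine ⟨s n + (n * m - n) + (m - r), ?_⟩
    rw [add_mul, one_mul]
    omega
  intro h0
  have h1 := hQ.measure_apply_eq_inter (n + t) (s n) (measurableSet_risingPath (s n))
  refine mul_ne_zero (hvisit t)
    ((ENNReal.ofReal_pos.2 hc).trans_le (hQ.le_risingPath h (s n))).ne' (h1.symm.trans ?_)
  refine measure_mono_null ?_ h0
  rintro ω ⟨_, hrise⟩
  refine ⟨n + t, fun k hk => ?_⟩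
  have hle : n + t ≤ k * m := hk.trans (Nat.le_mul_of_pos_right k hm)
  have h2 : ω (n + t + (k * m - (n + t))) = s n + (k * m - (n + t)) := hrise _
  rw [Nat.add_sub_cancel' hle] at h2
  have h3 : ω (k * m) + (n + 1) * m = r + k * m := by omega
  have h4 := congrArg (· % m) h3
  simp only [Nat.add_mul_mod_self_right] at h4
  rw [Nat.mod_eq_of_lt hr] at h4
  exact h4

lemma ae_mem_L_of_infinite_inter
    (hm : 0 < m) (hrise : ∀ᵐ ω ∂X.μ, ω ∈ eventuallyRising) {D : Set ℕ} (hD : X.Regular m D) {r : ℕ}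
    (hinf : (D ∩ residueClass m r).Infinite) :
    ∀ᵐ ω ∂X.μ, ω ∈ X.L m (residueClass m r) → ω ∈ X.L m D := by
  filter_upwards [hrise, (X.regular_iff_ae m D).1 hD] with ω h1 h2 hr
  exact h2 ((mem_U_iff_infinite hm h1 hr D).2 hinf)

lemma ae_mem_L_residueClass_of_mem_U
    (hm : 0 < m) (hrise : ∀ᵐ ω ∂X.μ, ω ∈ eventuallyRising) (r : ℕ) :
    ∀ᵐ ω ∂X.μ, ω ∈ X.U m (residueClass m r) → ω ∈ X.L m (residueClass m r) := by
  filter_upwards [hrise] with ω h1 hU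
  obtain ⟨s, _, hs⟩ := X.exists_mem_L_residueClass hm h1
  by_cases hrs : s = r
  · rwa [hrs] at hs
  · exact absurd hU (notMem_U_of_disjoint (disjoint_residueClass hrs) hs)

lemma almostClosed_inter_residueClass
    (hm : 0 < m) (hrise : ∀ᵐ ω ∂X.μ, ω ∈ eventuallyRising)
    (hpos : ∀ r < m, X.μ (X.L m (residueClass m r)) ≠ 0)
    {D : Set ℕ} (hD : X.Regular m D) {r : ℕ} (hr : r < m)
    (hinf : (D ∩ residueClass m r).Infinite) : X.AlmostClosed m (D ∩ residueClass m r) := by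
  have hL := ae_mem_L_of_infinite_inter hm hrise hD hinf
  constructor
  · rw [regular_iff_ae]
    filter_upwards [hL, ae_mem_L_residueClass_of_mem_U hm hrise r] with ω h1 h2 hU
    have hr := h2 (X.U_mono m inter_subset_right hU)
    rw [L_inter]
    exact ⟨h1 hr, hr⟩
  · intro htrans
    refine hpos r hr (measure_mono_null_ae ?_ htrans)
    filter_upwards [hL] with ω h1 hr
    refine X.L_subset_U m _ ?_
    rw [L_inter]
    exact ⟨h1 hr, hr⟩

lemma residueClass_infinite
    (hm : 0 < m) (hrise : ∀ᵐ ω ∂X.μ, ω ∈ eventuallyRising)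
    (hpos : ∀ r < m, X.μ (X.L m (residueClass m r)) ≠ 0)
    {r : ℕ} (hr : r < m) : (residueClass m r).Infinite := by
  obtain ⟨ω, h1, h2⟩ := ((frequently_ae_mem_iff.2 (hpos r hr)).and_eventually hrise).exists
  have := (mem_U_iff_infinite hm h2 h1 _).1 (X.L_subset_U m _ h1)
  rwa [inter_self] at this

lemma atomic_of_subset_residueClass
    (hm : 0 < m) (hrise : ∀ᵐ ω ∂X.μ, ω ∈ eventuallyRising)
    (hpos : ∀ r < m, X.μ (X.L m (residueClass m r)) ≠ 0)
    {C : Set ℕ} (hC : X.AlmostClosed m C) {r : ℕ} (hr : r < m)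
    (hCr : C ⊆ residueClass m r) : X.Atomic m C := by
  refine ⟨hC, ?_⟩
  rintro ⟨A, B, hA, hB, hAB, hAc, hBc⟩
  have key : ∀ D ⊆ C, X.AlmostClosed m D →
      ∀ᵐ ω ∂X.μ, ω ∈ X.L m (residueClass m r) → ω ∈ X.L m D := by
    intro D hDC hD
    refine ae_mem_L_of_infinite_inter hm hrise hD.1 ?_
    obtain ⟨ω, h1, h2⟩ := ((frequently_ae_mem_iff.2 hD.2).and_eventually hrise).exists
    obtain ⟨s, _, hs⟩ := X.exists_mem_L_residueClass hm h2
    have hinf := (mem_U_iff_infinite hm h2 hs D).1 h1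
    obtain ⟨x, hxD, hxs⟩ := hinf.nonempty
    have hrs : s = r := (show x % m = s from hxs).symm.trans (hCr (hDC hxD))
    rwa [hrs] at hinf
  obtain ⟨ω, h1, h2, h3⟩ := ((frequently_ae_mem_iff.2 (hpos r hr)).and_eventually
    ((key A hA hAc).and (key B hB hBc))).exists
  exact notMem_U_of_disjoint hAB (h2 h1) (X.L_subset_U m B (h3 h1))

lemma tsum_measure_L (X : MarkovChain ℕ) (m : ℕ) {𝒞 : Set (Set ℕ)} (hc : 𝒞.Countable)
    (hd : 𝒞.PairwiseDisjoint id) :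
    ∑' C : 𝒞, X.μ (X.L m (C : Set ℕ)) = X.μ (⋃ C ∈ 𝒞, X.L m C) := by
  refine (measure_biUnion hc ?_ fun C _ => X.measurableSet_L m C).symm
  intro C hC D hD hCD
  exact disjoint_left.2 fun ω h1 h2 =>
    notMem_U_of_disjoint (hd hC hD hCD) h1 (X.L_subset_U m D h2)

lemma isBlackwell_residueClass
    (hm : 0 < m) (hrise : ∀ᵐ ω ∂X.μ, ω ∈ eventuallyRising)
    (hpos : ∀ r < m, X.μ (X.L m (residueClass m r)) ≠ 0) : X.IsBlackwell m (residueClass m '' Iio m) := by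
  have := X.μ_prob
  have hclosed : ∀ r < m, X.AlmostClosed m (residueClass m r) := by
    intro r hr
    have hreg : X.Regular m (residueClass m r) :=
      (X.regular_iff_ae m _).2 (ae_mem_L_residueClass_of_mem_U hm hrise r)
    have := almostClosed_inter_residueClass hm hrise hpos hreg hr
      (by rw [inter_self]; exact residueClass_infinite hm hrise hpos hr)
    rwa [inter_self] at this
  have hatomic : ∀ C ∈ residueClass m '' Iio m, X.Atomic m C := by
    rintro _ ⟨r, hr, rfl⟩
    exact atomic_of_subset_residueClass hm hrise hpos (hclosed r hr) hr Subset.rfl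
  have hcount : (residueClass m '' Iio m).Countable := (to_countable _).image _
  have hdisj : (residueClass m '' Iio m).PairwiseDisjoint id := by
    rintro _ ⟨r, _, rfl⟩ _ ⟨s, _, rfl⟩ hne
    exact disjoint_residueClass fun h => hne (by rw [h])
  refine ⟨hcount, fun C hC => (hatomic C hC).1, hdisj, fun C hC _ _ h => absurd (hatomic C hC) h,
    fun C hC h => absurd (hatomic C hC) h, fun C hC h => absurd (hatomic C hC) h, ?_⟩
  rw [X.tsum_measure_L m hcount hdisj, ← prob_compl_eq_zero_iff
    (MeasurableSet.biUnion hcount fun C _ => X.measurableSet_L m C)]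
  refine measure_eq_zero_iff_ae_notMem.2 ?_
  filter_upwards [hrise] with ω hω h
  obtain ⟨r, hr, hrL⟩ := X.exists_mem_L_residueClass hm hω
  exact h (mem_biUnion (mem_image_of_mem _ hr) hrL)

lemma encard_Iio (m : ℕ) : (Iio m).encard = m := by
  rw [← Finset.coe_Iio, encard_coe_eq_coe_finsetCard, Nat.card_Iio]

lemma le_encard_of_isBlackwell
    (hm : 0 < m) (hrise : ∀ᵐ ω ∂X.μ, ω ∈ eventuallyRising)
    (hpos : ∀ r < m, X.μ (X.L m (residueClass m r)) ≠ 0)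
    {𝒞 : Set (Set ℕ)} (h𝒞 : X.IsBlackwell m 𝒞) :
    (m : ℕ∞) ≤ 𝒞.encard := by
  have := X.μ_prob
  have hcover : ∀ᵐ ω ∂X.μ, ∃ C ∈ 𝒞, ω ∈ X.L m C := by
    have h1 := h𝒞.sum_L_eq_one
    rw [X.tsum_measure_L m h𝒞.countable h𝒞.disjoint, ← prob_compl_eq_zero_iff
      (MeasurableSet.biUnion h𝒞.countable fun C _ => X.measurableSet_L m C)] at h1
    filter_upwards [measure_eq_zero_iff_ae_notMem.1 h1] with ω hω
    simpa using hω
  have hex : ∀ r, ∃ D, r < m → D ∈ 𝒞 ∧ (D ∩ residueClass m r).Infinite := by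
    intro r
    by_cases hr : r < m
    · obtain ⟨ω, h1, h2, D, hD, h3⟩ := ((frequently_ae_mem_iff.2 (hpos r hr)).and_eventually
        (hrise.and hcover)).exists
      exact ⟨D, fun _ => ⟨hD, (mem_U_iff_infinite hm h2 h1 D).1 (X.L_subset_U m D h3)⟩⟩
    · exact ⟨∅, fun h => absurd h hr⟩
  choose f hf using hex
  have hinj : InjOn f (Iio m) := by
    intro r hr s hs hrs
    by_contra hne
    obtain ⟨hD, hinf⟩ := hf r hr
    have hinf' := (hf s hs).2
    rw [← hrs] at hinf'
    have hreg := (h𝒞.almostClosed _ hD).1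
    have h1 := almostClosed_inter_residueClass hm hrise hpos hreg hr hinf
    have h2 := almostClosed_inter_residueClass hm hrise hpos hreg hs hinf'
    refine h𝒞.nonatomicNoAtomicSubset _ hD (fun hat => hat.2 ?_) _ inter_subset_left
      (atomic_of_subset_residueClass hm hrise hpos h1 hr inter_subset_right)
    exact ⟨_, _, inter_subset_left, inter_subset_left,
      (disjoint_residueClass hne).mono inter_subset_right inter_subset_right, h1, h2⟩
  rw [← encard_Iio m]
  exact encard_le_encard_of_injOn (fun r hr => (hf r hr).1) hinj

lemma beta_eq_of_ae_eventuallyRising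
    (hm : 0 < m) (hrise : ∀ᵐ ω ∂X.μ, ω ∈ eventuallyRising)
    (hpos : ∀ r < m, X.μ (X.L m (residueClass m r)) ≠ 0) : X.beta m = m := by
  have hB := isBlackwell_residueClass hm hrise hpos
  refine le_antisymm ?_ (le_csInf (Nonempty.image _ ⟨_, hB⟩) ?_)
  · refine (csInf_le' (mem_image_of_mem _ hB)).trans ?_
    exact (encard_image_le _ _).trans (encard_Iio m).le
  · rintro _ ⟨𝒞, h𝒞, rfl⟩
    exact le_encard_of_isBlackwell hm hrise hpos h𝒞

lemma period_eq_top_of_tendsto_prod_birth (hbd : X.IsBirthDeath) {c : ℝ} (hc : 0 < c)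
    (h : Tendsto (fun n => ∏ i ∈ Finset.range n, X.P i (i + 1)) atTop (nhds c)) :
    X.period = ⊤ := by
  obtain ⟨Q, hQ⟩ := X.exists_isMarkovFamily hbd.exists_pathCylinder_ne_zero
  refine ENat.eq_top_iff_forall_ge.2 fun n => ?_
  have hle : ((n + 1 : ℕ) : ℕ∞) ≤ X.period := le_sSup ⟨n + 1, by omega,
    beta_eq_of_ae_eventuallyRising n.succ_pos (hQ.ae_mem_eventuallyRising hc h)
      fun r hr => hQ.L_residueClass_ne_zero hbd hc h n.succ_pos hr, rfl⟩
  exact le_trans (by exact_mod_cast n.le_succ) hle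

end MarkovChain

/-- A birth-death process `X` has asymptotic period `d(X) = ∞` if
and only if the infinite product `∏ p_i` is strictly positive (i.e. the partial
products converge to a positive limit). -/
theorem stmt15 (X : MarkovChain ℕ) (hbd : X.IsBirthDeath)
    (hirr : X.Irreducible) (hap : X.Aperiodic) :
    X.period = ⊤ ↔
      ∃ c : ℝ, 0 < c ∧
        Tendsto (fun n => ∏ i ∈ Finset.range n, X.P i (i + 1)) atTop (nhds c) := by
  exact ⟨fun hp => MarkovChain.exists_tendsto_prod_birth_of_period_eq_top hbd hp,
    fun ⟨_, hc, h⟩ => MarkovChain.period_eq_top_of_tendsto_prod_birth hbd hc h⟩
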